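/- Let A, B > 0, let a, b be positive integers, let N ≥ 2 be an integer, and suppose the sensing radius satisfies r_s ≥ sin(π/N)·√(A² + B²). For the 1-clustered splay configuration θ_i = θ₀ + 2πi/N, i = 0, …, N−1, with robot positions p_i(γ) = (A cos(θ_i − aγ), B sin(θ_i + bγ)), the distance between adjacent robots satisfies ‖p_i(γ) − p_{i+1}(γ)‖ ≤ 2 r_s for every γ ∈ ℝ and every i (indices mod N); i.e., the closed sensing disks of radius r_s centered at adjacent robots always intersect. -/

import Mathlib

open Real

/-- Advancing both phases by `2 * δ` moves a point `(A cos x, B sin y)` by at most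
`2 * |sin δ| * √(A ^ 2 + B ^ 2)`, in squared form. -/
lemma sq_cos_sub_add_sq_sin_sub_le (A B x y δ : ℝ) :
    (A * cos x - A * cos (x + 2 * δ)) ^ 2 + (B * sin y - B * sin (y + 2 * δ)) ^ 2 ≤
      (2 * sin δ) ^ 2 * (A ^ 2 + B ^ 2) := by
  have hcos : cos x - cos (x + 2 * δ) = 2 * sin δ * sin (x + δ) := by
    rw [cos_sub_cos, show (x + (x + 2 * δ)) / 2 = x + δ by ring,
      show (x - (x + 2 * δ)) / 2 = -δ by ring, sin_neg]
    ring
  have hsin : sin y - sin (y + 2 * δ) = -(2 * sin δ * cos (y + δ)) := by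
    rw [sin_sub_sin, show (y + (y + 2 * δ)) / 2 = y + δ by ring,
      show (y - (y + 2 * δ)) / 2 = -δ by ring, sin_neg]
    ring
  rw [← mul_sub, ← mul_sub, hcos, hsin]
  calc (A * (2 * sin δ * sin (x + δ))) ^ 2 + (B * -(2 * sin δ * cos (y + δ))) ^ 2
      = (2 * sin δ) ^ 2 * (A ^ 2 * sin (x + δ) ^ 2 + B ^ 2 * cos (y + δ) ^ 2) := by ring
    _ ≤ (2 * sin δ) ^ 2 * (A ^ 2 * 1 + B ^ 2 * 1) := by
        gcongr
        · exact sin_sq_le_one _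
        · exact cos_sq_le_one _
    _ = (2 * sin δ) ^ 2 * (A ^ 2 + B ^ 2) := by ring

/-- Under the target-detection sensing condition
`r_s ≥ sin(π/N) √(A² + B²)`, in the 1-clustered splay configuration
`θ_i = θ₀ + 2πi/N` the positions `p_i(γ) = (A cos(θ_i − aγ), B sin(θ_i + bγ))`
of adjacent robots satisfy `‖p_i(γ) − p_{i+1}(γ)‖ ≤ 2 r_s` for every `γ` and
every index `i`, so adjacent sensing disks always intersect. -/
theorem adjacent_robots_within_two_sensing_radii
    (A B : ℝ) (hA : 0 < A) (hB : 0 < B)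
    (a b : ℕ) (ha : 0 < a) (hb : 0 < b)
    (N : ℕ) (hN : 2 ≤ N) (θ₀ : ℝ) (rs : ℝ)
    (hrs : rs ≥ Real.sin (π / N) * Real.sqrt (A ^ 2 + B ^ 2))
    (θs : ℤ → ℝ) (hθs : ∀ i : ℤ, θs i = θ₀ + 2 * π * i / N) :
    ∀ (i : ℤ) (γ : ℝ),
      Real.sqrt
          ((A * Real.cos (θs i - a * γ) -
              A * Real.cos (θs (i + 1) - a * γ)) ^ 2 +
            (B * Real.sin (θs i + b * γ) -
              B * Real.sin (θs (i + 1) + b * γ)) ^ 2) ≤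
        2 * rs := by
  intro i γ
  have hN' : (0 : ℝ) < N := by positivity
  have hsin : 0 ≤ sin (π / N) := by
    apply sin_nonneg_of_nonneg_of_le_pi (by positivity)
    exact div_le_self pi_pos.le (by exact_mod_cast (by omega : 1 ≤ N))
  have hstep : θs (i + 1) = θs i + 2 * (π / N) := by
    rw [hθs, hθs]
    push_cast
    field_simp
    ring
  have hbound := sq_cos_sub_add_sq_sin_sub_le A B (θs i - a * γ) (θs i + b * γ) (π / N)
  rw [hstep, add_sub_right_comm, add_right_comm]
  refine (sqrt_le_left (by positivity)).2 ?_ |>.trans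
    (mul_le_mul_of_nonneg_left hrs zero_le_two)
  rwa [mul_pow, mul_pow, sq_sqrt (by positivity), ← mul_assoc, ← mul_pow]
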